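/- If the 4×4 complex Hermitian matrix Q is positive semidefinite, then E₀ ≥ √(A + |c'|² + |J₍₄₎|²) − |c'| − |J₍₄₎|. (In the paper this is derived from the nonnegativity of the sum of the third-order principal minors of Q together with the second-order minor inequalities, treating the cases E₀ > 0 and E₀ = 0 separately.) -/

import Mathlib

noncomputable section

open Matrix
open scoped ComplexOrder

/-- Euclidean dot product on ℝ³. -/
def dot3 (u v : Fin 3 → ℝ) : ℝ := u 0 * v 0 + u 1 * v 1 + u 2 * v 2

/-- Cross product on ℝ³. -/
def cross3 (u v : Fin 3 → ℝ) : Fin 3 → ℝ :=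
  ![u 1 * v 2 - u 2 * v 1, u 2 * v 0 - u 0 * v 2, u 0 * v 1 - u 1 * v 0]

/-- Euclidean norm on ℝ³. -/
def norm3 (u : Fin 3 → ℝ) : ℝ := Real.sqrt (dot3 u u)

/-- The 4×4 Hermitian matrix Q = [[E, L], [L*, Ê]] from the positive energy theorem. -/
def Qmat (E₀ c₁ c₂ c₃ c₄ c₁' c₂' c₃' c₄' J₁₂ J₁₃ J₂₃ J₁₄ J₂₄ J₃₄ : ℝ) :
    Matrix (Fin 4) (Fin 4) ℂ :=
  !![((E₀ + c₄ + c₃' - J₃₄ : ℝ) : ℂ),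
     (c₁' : ℂ) + Complex.I * (c₂' : ℂ) - (J₁₄ : ℂ) - Complex.I * (J₂₄ : ℂ),
     (c₃ : ℂ) - (c₄' : ℂ) + Complex.I * (J₁₂ : ℂ),
     (c₁ : ℂ) + Complex.I * (c₂ : ℂ) + (J₁₃ : ℂ) + Complex.I * (J₂₃ : ℂ);
     (c₁' : ℂ) - Complex.I * (c₂' : ℂ) - (J₁₄ : ℂ) + Complex.I * (J₂₄ : ℂ),
     ((E₀ + c₄ - c₃' + J₃₄ : ℝ) : ℂ),
     (c₁ : ℂ) - Complex.I * (c₂ : ℂ) - (J₁₃ : ℂ) + Complex.I * (J₂₃ : ℂ),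
     -(c₃ : ℂ) - (c₄' : ℂ) - Complex.I * (J₁₂ : ℂ);
     (c₃ : ℂ) - (c₄' : ℂ) - Complex.I * (J₁₂ : ℂ),
     (c₁ : ℂ) + Complex.I * (c₂ : ℂ) - (J₁₃ : ℂ) - Complex.I * (J₂₃ : ℂ),
     ((E₀ - c₄ - c₃' - J₃₄ : ℝ) : ℂ),
     -(c₁' : ℂ) - Complex.I * (c₂' : ℂ) - (J₁₄ : ℂ) - Complex.I * (J₂₄ : ℂ);
     (c₁ : ℂ) - Complex.I * (c₂ : ℂ) + (J₁₃ : ℂ) - Complex.I * (J₂₃ : ℂ),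
     -(c₃ : ℂ) - (c₄' : ℂ) + Complex.I * (J₁₂ : ℂ),
     -(c₁' : ℂ) + Complex.I * (c₂' : ℂ) - (J₁₄ : ℂ) + Complex.I * (J₂₄ : ℂ),
     ((E₀ - c₄ + c₃' + J₃₄ : ℝ) : ℂ)]

theorem dot3_self_nonneg (u : Fin 3 → ℝ) : 0 ≤ dot3 u u := by
  unfold dot3
  linarith [mul_self_nonneg (u 0), mul_self_nonneg (u 1), mul_self_nonneg (u 2)]

theorem norm3_nonneg (u : Fin 3 → ℝ) : 0 ≤ norm3 u := Real.sqrt_nonneg _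

theorem norm3_sq (u : Fin 3 → ℝ) : norm3 u ^ 2 = dot3 u u :=
  Real.sq_sqrt (dot3_self_nonneg u)

/-- Lagrange's identity. -/
theorem dot3_cross3_self (u v : Fin 3 → ℝ) :
    dot3 (cross3 u v) (cross3 u v) = dot3 u u * dot3 v v - dot3 u v ^ 2 := by
  simp [dot3, cross3]
  ring

theorem dot3_smul_self (r : ℝ) (u : Fin 3 → ℝ) : dot3 (r • u) (r • u) = r ^ 2 * dot3 u u := by
  simp [dot3]
  ring

theorem dot3_sq_le (u v : Fin 3 → ℝ) : dot3 u v ^ 2 ≤ dot3 u u * dot3 v v := by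
  linarith [dot3_cross3_self u v, dot3_self_nonneg (cross3 u v)]

theorem dot3_le_norm3_mul {u v : Fin 3 → ℝ} {r : ℝ} (hr : 0 ≤ r) (hv : dot3 v v ≤ r ^ 2) :
    dot3 u v ≤ norm3 u * r := by
  refine abs_le_of_sq_le_sq' ?_ (mul_nonneg (norm3_nonneg u) hr) |>.2
  rw [mul_pow, norm3_sq]
  exact (dot3_sq_le u v).trans (mul_le_mul_of_nonneg_left hv (dot3_self_nonneg u))

/-- The order-two principal minors of a positive semidefinite matrix are nonnegative. -/
theorem Matrix.PosSemidef.minor_two_nonneg {n : Type*} {M : Matrix n n ℂ} (hM : M.PosSemidef)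
    (i j : n) : 0 ≤ (M i i * M j j - M i j * M j i).re := by
  have h := (hM.submatrix ![i, j]).det_nonneg
  rw [det_fin_two] at h
  exact (Complex.le_def.mp h).1

/-- The order-three principal minors of a positive semidefinite matrix are nonnegative. -/
theorem Matrix.PosSemidef.minor_three_nonneg {n : Type*} {M : Matrix n n ℂ} (hM : M.PosSemidef)
    (i j k : n) : 0 ≤ (M i i * M j j * M k k - M i i * M j k * M k j - M i j * M j i * M k k +
      M i j * M j k * M k i + M i k * M j i * M k j - M i k * M j j * M k i).re := by
  have h := (hM.submatrix ![i, j, k]).det_nonneg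
  rw [det_fin_three] at h
  exact (Complex.le_def.mp h).1

section Qmat

variable {E₀ c₁ c₂ c₃ c₄ c₁' c₂' c₃' c₄' J₁₂ J₁₃ J₂₃ J₁₄ J₂₄ J₃₄ : ℝ}

theorem Qmat_energy_nonneg
    (hQ : (Qmat E₀ c₁ c₂ c₃ c₄ c₁' c₂' c₃' c₄' J₁₂ J₁₃ J₂₃ J₁₄ J₂₄ J₃₄).PosSemidef) :
    0 ≤ E₀ := by
  have h := fun i => (Complex.le_def.mp (hQ.diag_nonneg (i := i))).1
  have h0 := h 0
  have h1 := h 1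
  have h2 := h 2
  have h3 := h 3
  simp [Qmat] at h0 h1 h2 h3
  linarith

/-- The minors on the index pairs `{0, 2}`, `{1, 3}`, `{0, 3}`, `{1, 2}`, summed. -/
theorem Qmat_minor_two_offDiag
    (hQ : (Qmat E₀ c₁ c₂ c₃ c₄ c₁' c₂' c₃' c₄' J₁₂ J₁₃ J₂₃ J₁₄ J₂₄ J₃₄).PosSemidef) :
    dot3 ![c₁, c₂, c₃] ![c₁, c₂, c₃] + dot3 ![J₂₃, -J₁₃, J₁₂] ![J₂₃, -J₁₃, J₁₂] + c₄' ^ 2 +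
      2 * c₄ ^ 2 ≤ 2 * E₀ ^ 2 := by
  have h02 := hQ.minor_two_nonneg 0 2
  have h13 := hQ.minor_two_nonneg 1 3
  have h03 := hQ.minor_two_nonneg 0 3
  have h12 := hQ.minor_two_nonneg 1 2
  simp [Qmat] at h02 h13 h03 h12
  simp [dot3]
  linarith

/-- The minors on the index pairs `{0, 1}` and `{2, 3}`, summed. -/
theorem Qmat_minor_two_diag
    (hQ : (Qmat E₀ c₁ c₂ c₃ c₄ c₁' c₂' c₃' c₄' J₁₂ J₁₃ J₂₃ J₁₄ J₂₄ J₃₄).PosSemidef) :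
    dot3 ![c₁', c₂', c₃'] ![c₁', c₂', c₃'] + dot3 ![J₁₄, J₂₄, J₃₄] ![J₁₄, J₂₄, J₃₄] ≤
      E₀ ^ 2 + c₄ ^ 2 := by
  have h01 := hQ.minor_two_nonneg 0 1
  have h23 := hQ.minor_two_nonneg 2 3
  simp [Qmat] at h01 h23
  simp [dot3]
  linarith

/-- The third elementary symmetric function of the eigenvalues is nonnegative. -/
theorem Qmat_minor_three
    (hQ : (Qmat E₀ c₁ c₂ c₃ c₄ c₁' c₂' c₃' c₄' J₁₂ J₁₃ J₂₃ J₁₄ J₂₄ J₃₄).PosSemidef) :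
    E₀ * (c₄ ^ 2 + c₄' ^ 2 + dot3 ![c₁, c₂, c₃] ![c₁, c₂, c₃] +
        dot3 ![c₁', c₂', c₃'] ![c₁', c₂', c₃'] + dot3 ![J₂₃, -J₁₃, J₁₂] ![J₂₃, -J₁₃, J₁₂] +
        dot3 ![J₁₄, J₂₄, J₃₄] ![J₁₄, J₂₄, J₃₄]) ≤
      E₀ ^ 3 + 2 * (dot3 ![c₁', c₂', c₃'] (cross3 ![J₂₃, -J₁₃, J₁₂] ![c₁, c₂, c₃]) +
        dot3 ![J₁₄, J₂₄, J₃₄] (c₄' • ![c₁, c₂, c₃]) +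
        dot3 ![c₁', c₂', c₃'] (-c₄ • ![J₁₄, J₂₄, J₃₄])) := by
  have h012 := hQ.minor_three_nonneg 0 1 2
  have h013 := hQ.minor_three_nonneg 0 1 3
  have h023 := hQ.minor_three_nonneg 0 2 3
  have h123 := hQ.minor_three_nonneg 1 2 3
  simp [Qmat] at h012 h013 h023 h123
  simp [dot3, cross3]
  linarith

end Qmat

theorem stmt3 (E₀ c₁ c₂ c₃ c₄ c₁' c₂' c₃' c₄' J₁₂ J₁₃ J₂₃ J₁₄ J₂₄ J₃₄ : ℝ)
    (hQ : (Qmat E₀ c₁ c₂ c₃ c₄ c₁' c₂' c₃' c₄' J₁₂ J₁₃ J₂₃ J₁₄ J₂₄ J₃₄).PosSemidef) :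
    E₀ ≥ Real.sqrt ((c₄ ^ 2 + c₄' ^ 2 + norm3 ![c₁, c₂, c₃] ^ 2 + norm3 ![c₁', c₂', c₃'] ^ 2 + norm3 ![J₂₃, -J₁₃, J₁₂] ^ 2 + norm3 ![J₁₄, J₂₄, J₃₄] ^ 2) + norm3 ![c₁', c₂', c₃'] ^ 2 + norm3 ![J₁₄, J₂₄, J₃₄] ^ 2)
      - norm3 ![c₁', c₂', c₃'] - norm3 ![J₁₄, J₂₄, J₃₄] := by
  have hE := Qmat_energy_nonneg hQ
  have hoff := Qmat_minor_two_offDiag hQ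
  have hdiag := Qmat_minor_two_diag hQ
  have hthree := Qmat_minor_three hQ
  simp only [norm3_sq ![c₁, c₂, c₃], norm3_sq ![J₂₃, -J₁₃, J₁₂]]
  rw [← norm3_sq ![c₁', c₂', c₃'], ← norm3_sq ![J₁₄, J₂₄, J₃₄]] at hdiag hthree
  have hc := dot3_self_nonneg ![c₁, c₂, c₃]
  have hJ := dot3_self_nonneg ![J₂₃, -J₁₃, J₁₂]
  have ha := norm3_nonneg ![c₁', c₂', c₃']
  have hb := norm3_nonneg ![J₁₄, J₂₄, J₃₄]
  have hcross : dot3 ![c₁', c₂', c₃'] (cross3 ![J₂₃, -J₁₃, J₁₂] ![c₁, c₂, c₃]) ≤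
      norm3 ![c₁', c₂', c₃'] * E₀ ^ 2 := by
    refine dot3_le_norm3_mul (sq_nonneg E₀) ?_
    rw [dot3_cross3_self]
    generalize dot3 ![c₁, c₂, c₃] ![c₁, c₂, c₃] = p at *
    generalize dot3 ![J₂₃, -J₁₃, J₁₂] ![J₂₃, -J₁₃, J₁₂] = q at *
    have hpq : p + q ≤ 2 * E₀ ^ 2 := by nlinarith
    nlinarith [sq_nonneg (p - q), sq_nonneg (dot3 ![J₂₃, -J₁₃, J₁₂] ![c₁, c₂, c₃])]
  have hsmul : dot3 ![J₁₄, J₂₄, J₃₄] (c₄' • ![c₁, c₂, c₃]) ≤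
      norm3 ![J₁₄, J₂₄, J₃₄] * E₀ ^ 2 := by
    refine dot3_le_norm3_mul (sq_nonneg E₀) ?_
    rw [dot3_smul_self]
    generalize dot3 ![c₁, c₂, c₃] ![c₁, c₂, c₃] = p at *
    have hp : p + c₄' ^ 2 ≤ 2 * E₀ ^ 2 := by nlinarith
    nlinarith [sq_nonneg (p - c₄' ^ 2), sq_nonneg c₄']
  have hneg : dot3 ![c₁', c₂', c₃'] (-c₄ • ![J₁₄, J₂₄, J₃₄]) ≤
      norm3 ![c₁', c₂', c₃'] * (E₀ * norm3 ![J₁₄, J₂₄, J₃₄]) := by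
    refine dot3_le_norm3_mul (mul_nonneg hE hb) ?_
    rw [dot3_smul_self, ← norm3_sq, neg_sq, mul_pow]
    exact mul_le_mul_of_nonneg_right (by nlinarith) (sq_nonneg _)
  generalize norm3 ![c₁', c₂', c₃'] = a at *
  generalize norm3 ![J₁₄, J₂₄, J₃₄] = b at *
  generalize dot3 ![c₁, c₂, c₃] ![c₁, c₂, c₃] = p at *
  generalize dot3 ![J₂₃, -J₁₃, J₁₂] ![J₂₃, -J₁₃, J₁₂] = q at *
  have hA : c₄ ^ 2 + c₄' ^ 2 + p + a ^ 2 + q + b ^ 2 ≤ E₀ ^ 2 + 2 * E₀ * (a + b) + 2 * a * b := by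
    rcases hE.eq_or_lt with rfl | hpos
    · nlinarith [mul_nonneg ha hb]
    · refine le_of_mul_le_mul_left ?_ hpos
      linarith
  have hsqrt : √(c₄ ^ 2 + c₄' ^ 2 + p + a ^ 2 + q + b ^ 2 + a ^ 2 + b ^ 2) ≤ E₀ + a + b :=
    Real.sqrt_le_iff.mpr ⟨by positivity, by linarith⟩
  linarith
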